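/- arXiv:1611.07506 — 2 statements merged into one kernel-verified Lean document; each statement's English description precedes it below -/
import Mathlib

section
/- Let R = k[x_1,...,x_n] over a field and let F ∈ R^{m×n} with m > n be a unimodular matrix (i.e., the ideal of n×n minors of F is R). Then there exists a unimodular square matrix M ∈ R^{m×m} and a matrix so that M·F equals the block matrix [I_n; 0] ∈ R^{m×n}. -/
namespace QS

open Polynomial in
lemma stable {A : Type*} [CommRing A] [IsDomain A] [IsPrincipalIdealRing A] (a b c : A)
    (ha : a ≠ 0) (h : ∀ p, Prime p → p ∣ a → p ∣ b → ¬ p ∣ c) :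
    ∃ t, IsCoprime a (b + t * c) := by
  classical
  let s := (UniqueFactorizationMonoid.factors a).filter (fun q => ¬ q ∣ b)
  refine ⟨s.prod, isCoprime_of_prime_dvd (fun h => ha h.1) ?_⟩
  intro p hp hpa hpb
  by_cases hb : p ∣ b
  · have h1 : p ∣ s.prod * c := (dvd_add_right hb).1 hpb
    rcases hp.dvd_or_dvd h1 with h2 | h2
    · obtain ⟨q, hq, hpq⟩ := (Multiset.prod_induction (fun x => p ∣ x → ∃ q ∈ s, p ∣ q) s
        (fun x y hx hy hxy => (hp.dvd_or_dvd hxy).elim hx hy)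
        (fun h1 => absurd (isUnit_of_dvd_one h1) hp.not_isUnit) (fun x hx hpx => ⟨x, hx, hpx⟩)) h2
      have hq' := Multiset.mem_filter.1 hq
      have hqp := UniqueFactorizationMonoid.prime_of_factor q hq'.1
      exact hq'.2 ((hp.associated_of_dvd hqp hpq).dvd'.trans hb)
    · exact h p hp hpa hb h2
  · obtain ⟨q, hq, hpq⟩ := UniqueFactorizationMonoid.exists_mem_factors_of_dvd ha hp.irreducible hpa
    have : p ∣ s.prod := hpq.dvd.trans (Multiset.dvd_prod (Multiset.mem_filter.2
      ⟨hq, fun hqb => hb (hpq.dvd.trans hqb)⟩))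
    exact hb ((dvd_add_left (this.mul_right c)).1 hpb)

lemma stableVec {A : Type*} [CommRing A] [IsDomain A] [IsPrincipalIdealRing A]
    {ι : Type*} [Fintype ι] [DecidableEq ι] (v u : ι → A) (h : ∑ i, u i * v i = 1)
    (i₀ i₁ : ι) (h0 : v i₀ ≠ 0) :
    ∃ a : ι → A, a i₀ = 0 ∧ a i₁ = 0 ∧ IsCoprime (v i₀) (v i₁ + ∑ j, a j * v j) := by
  let s : ι → A := fun j => if j = i₀ ∨ j = i₁ then 0 else v j
  obtain ⟨c, hc⟩ := (IsPrincipalIdealRing.principal (Ideal.span (Set.range s))).principal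
  have hc' : Ideal.span (Set.range s) = Ideal.span {c} := hc
  have hcm : c ∈ Ideal.span (Set.range s) := hc' ▸ Ideal.mem_span_singleton_self c
  obtain ⟨z, hz⟩ := Ideal.mem_span_range_iff_exists_fun.1 hcm
  have hd : ∀ j, c ∣ s j := fun j => Ideal.mem_span_singleton.1
    (hc' ▸ Ideal.subset_span (Set.mem_range_self j))
  obtain ⟨t, ht⟩ := stable (v i₀) (v i₁) c h0 (by
    intro p hp h1 h2 h3
    refine hp.not_isUnit (isUnit_of_dvd_one (h ▸ Finset.dvd_sum fun j _ => Dvd.dvd.mul_left ?_ _))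
    by_cases e0 : j = i₀
    · exact e0 ▸ h1
    by_cases e1 : j = i₁
    · exact e1 ▸ h2
    have := h3.trans (hd j)
    simpa [s, e0, e1] using this)
  refine ⟨fun j => if j = i₀ ∨ j = i₁ then 0 else t * z j, by simp, by simp, ?_⟩
  convert ht using 2
  rw [← hz, Finset.mul_sum]
  refine Finset.sum_congr rfl fun j _ => ?_
  simp only [s]
  split_ifs <;> ring

section
variable {ι : Type*} [Fintype ι] [DecidableEq ι]

def VEq {A : Type*} [CommRing A] (v w : ι → A) : Prop :=
  ∃ M : Matrix ι ι A, IsUnit M.det ∧ M.mulVec v = w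

variable {A : Type*} [CommRing A]

lemma VEq.refl (v : ι → A) : VEq v v := ⟨1, by simp, by simp⟩

lemma VEq.trans {u v w : ι → A} (h : VEq u v) (h' : VEq v w) : VEq u w := by
  obtain ⟨M, hM, rfl⟩ := h
  obtain ⟨M', hM', rfl⟩ := h'
  exact ⟨M' * M, by simpa using ⟨hM', hM⟩, by simp⟩

lemma VEq.symm {u v : ι → A} (h : VEq u v) : VEq v u := by
  obtain ⟨M, hM, rfl⟩ := h
  exact ⟨M⁻¹, by simpa using hM, by simp [Matrix.nonsing_inv_mul _ hM]⟩

lemma VEq.map {B : Type*} [CommRing B] (f : A →+* B) {u v : ι → A} (h : VEq u v) :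
    VEq (fun i => f (u i)) (fun i => f (v i)) := by
  obtain ⟨M, hM, rfl⟩ := h
  refine ⟨f.mapMatrix M, ?_, ?_⟩
  · rw [← RingHom.map_det]; exact hM.map f
  · funext i
    simp [Matrix.mulVec, dotProduct]

lemma VEq.of_equiv (e : (ι → A) ≃ₗ[A] (ι → A)) (v : ι → A) : VEq v (e v) := by
  refine ⟨LinearMap.toMatrix' e.toLinearMap, ?_, ?_⟩
  · rw [LinearMap.det_toMatrix']; exact LinearEquiv.isUnit_det' e
  · rw [LinearMap.toMatrix'_mulVec]; rfl

lemma VEq.trv (a w v : ι → A) (h : ∑ i, a i * w i = 0) : VEq v (v + (∑ i, a i * v i) • w) := by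
  let f : Module.Dual A (ι → A) := ∑ i, a i • LinearMap.proj i
  have hf : ∀ x, f x = ∑ i, a i * x i := fun x => by simp [f]
  have := VEq.of_equiv (LinearEquiv.transvection (f := f) (v := w) (by rw [hf, h])) v
  simpa [LinearMap.transvection.apply, hf] using this

lemma VEq.two (i₀ i₁ : ι) (hi : i₀ ≠ i₁) (p q r s : A) (h : p * s - q * r = 1) (v : ι → A) :
    VEq v (fun j => if j = i₀ then p * v i₀ + q * v i₁ else
      if j = i₁ then r * v i₀ + s * v i₁ else v j) := by
  let e : (ι → A) ≃ₗ[A] (ι → A) :=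
    { toFun := fun v j => if j = i₀ then p * v i₀ + q * v i₁ else
        if j = i₁ then r * v i₀ + s * v i₁ else v j
      invFun := fun v j => if j = i₀ then s * v i₀ - q * v i₁ else
        if j = i₁ then p * v i₁ - r * v i₀ else v j
      map_add' := by
        intro x y; funext j; simp only [Pi.add_apply]; split_ifs <;> ring
      map_smul' := by
        intro x y; funext j; simp only [Pi.smul_apply, smul_eq_mul, RingHom.id_apply]
        split_ifs <;> ring
      left_inv := by
        intro x; funext j
        simp only [hi.symm, if_true, if_false]
        split_ifs with h1 h2
        · subst h1; linear_combination (x j) * h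
        · subst h2; linear_combination (x j) * h
        · rfl
      right_inv := by
        intro x; funext j
        simp only [hi.symm, if_true, if_false]
        split_ifs with h1 h2
        · subst h1; linear_combination (x j) * h
        · subst h2; linear_combination (x j) * h
        · rfl }
  exact VEq.of_equiv e v

/-- a vector with a unit entry at `i₁` can be turned into any vector with unit entry -/
lemma VEq.single_of_unit (i₀ i₁ : ι) (hi : i₀ ≠ i₁) (v : ι → A) (h : IsUnit (v i₁)) :
    VEq v (Pi.single i₀ 1) := by
  obtain ⟨u, hu⟩ := h.exists_left_inv
  -- make entry `i₀` one
  have h1 := VEq.trv (Pi.single i₁ (u * (1 - v i₀))) (Pi.single i₀ 1) v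
    (by simp [Pi.single_apply, hi])
  refine h1.trans ?_
  set w := v + (∑ i, (Pi.single i₁ (u * (1 - v i₀)) : ι → A) i * v i) • (Pi.single i₀ 1 : ι → A) with hw
  have hw0 : w i₀ = 1 := by
    simp [hw, Pi.single_apply]; linear_combination (1 - v i₀) * hu
  have h2 := VEq.trv (Pi.single i₀ 1) (Pi.single i₀ 1 - w) w
    (by simp [Pi.single_apply, hw0])
  simpa [Pi.single_apply, hw0] using h2

end

section
universe u
open Polynomial

lemma exists_const {R K : Type*} [CommRing R] [Field K] (φ : R →+* K) (f g : R[X])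
    (hf : f.Monic) (h : IsCoprime (f.map φ) (g.map φ)) :
    ∃ c, φ c ≠ 0 ∧ ∃ p q, f * p + g * q = C c := by
  by_cases hd : f.natDegree = 0
  · obtain rfl := eq_one_of_monic_natDegree_zero hf hd
    exact ⟨1, by simp, 1, 0, by simp⟩
  obtain ⟨p, q, -, -, e⟩ := exists_mul_add_mul_eq_C_resultant f g le_rfl le_rfl (by simp [hd])
  refine ⟨_, ?_, p, q, e⟩
  intro hc
  rw [← resultant_map_map] at hc
  have hu := (isUnit_resultant_iff_isCoprime (hf.map φ)).2 h
  rw [hf.natDegree_map] at hu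
  obtain ⟨k, hk⟩ := Nat.exists_eq_add_of_le (natDegree_map_le (f := φ) (p := g))
  rw [hk, resultant_add_right_deg _ _ _ _ _ le_rfl, coeff_map, coeff_natDegree, hf.leadingCoeff] at hc
  simp only [map_one, one_pow, one_mul] at hc
  exact hu.ne_zero hc

variable {ι : Type*} [Fintype ι] [DecidableEq ι]

lemma comp_sub_dvd {R : Type*} [CommRing R] (f b b' c : R[X]) (h : c ∣ b' - b) :
    ∃ F, f.comp b' = f.comp b + c * F := by
  obtain ⟨F, hF⟩ := h.trans (by
    have := Polynomial.sub_dvd_eval_sub b' b (f.map C)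
    simpa [Polynomial.eval_map, Polynomial.comp] using this : b' - b ∣ f.comp b' - f.comp b)
  exact ⟨F, by rw [← hF]; ring⟩

lemma suslin_step {R : Type*} [CommRing R] [IsDomain R] (v : ι → R[X]) (i₀ i₁ : ι) (hi : i₀ ≠ i₁)
    (c : R) (hc : c ≠ 0) (p q : R[X]) (h : v i₀ * p + v i₁ * q = C c)
    (b b' : R[X]) (hb : C c ∣ b' - b) :
    VEq (fun i => (v i).comp b) (fun i => (v i).comp b') := by
  choose D hD using fun i => comp_sub_dvd (v i) b b' (C c) hb
  obtain ⟨P, hP⟩ := comp_sub_dvd p b b' (C c) hb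
  obtain ⟨Q, hQ⟩ := comp_sub_dvd q b b' (C c) hb
  have e1 : (v i₀).comp b * p.comp b + (v i₁).comp b * q.comp b = C c := by
    simpa using congrArg (fun x => x.comp b) h
  have e2 : (v i₀).comp b' * p.comp b' + (v i₁).comp b' * q.comp b' = C c := by
    simpa using congrArg (fun x => x.comp b') h
  have hc' : (C c : R[X]) ≠ 0 := by simpa using hc
  set f := (v i₀).comp b with hf
  set g := (v i₁).comp b with hg
  rw [hD i₀, hD i₁, hP, hQ] at e2
  rw [← hf, ← hg] at e2
  set l := q.comp b
  set k := p.comp b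
  have hdet : (1 + D i₀ * k + Q * g) * (1 + D i₁ * l + P * f) - (D i₀ * l - Q * f) * (D i₁ * k - P * g) = 1 := by
    apply mul_left_cancel₀ (mul_ne_zero hc' hc')
    have x1 : C c * (1 + D i₀ * k + Q * g) = (f + C c * D i₀) * k + (l + C c * Q) * g := by
      linear_combination -e1
    have x2 : C c * (1 + D i₁ * l + P * f) = (g + C c * D i₁) * l + (k + C c * P) * f := by
      linear_combination -e1
    calc _ = (C c * (1 + D i₀ * k + Q * g)) * (C c * (1 + D i₁ * l + P * f)) - 
          (C c * (D i₀ * l - Q * f)) * (C c * (D i₁ * k - P * g)) := by ring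
      _ = ((f + C c * D i₀) * (k + C c * P) + (g + C c * D i₁) * (l + C c * Q)) *
          (f * k + g * l) := by rw [x1, x2]; ring
      _ = _ := by rw [e1, e2]; ring
  have h1 := VEq.two i₀ i₁ hi _ _ _ _ hdet (fun i => (v i).comp b)
  refine h1.trans ?_
  simp only [← hf, ← hg]
  have y0 : (1 + D i₀ * k + Q * g) * f + (D i₀ * l - Q * f) * g = (v i₀).comp b' := by
    rw [hD]; linear_combination D i₀ * e1
  have y1 : (D i₁ * k - P * g) * f + (1 + D i₁ * l + P * f) * g = (v i₁).comp b' := by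
    rw [hD]; linear_combination D i₁ * e1
  rw [y0, y1]
  set w : ι → R[X] := fun j => if j = i₀ then (v i₀).comp b' else
      if j = i₁ then (v i₁).comp b' else (v j).comp b with hw
  have w0 : w i₀ = (v i₀).comp b' := by simp [hw]
  have w1 : w i₁ = (v i₁).comp b' := by simp [hw, hi.symm]
  have h2 := VEq.trv (Pi.single i₀ (p.comp b') + Pi.single i₁ (q.comp b'))
    (fun j => if j = i₀ then 0 else if j = i₁ then 0 else D j) w
    (by
      refine Finset.sum_eq_zero fun j _ => ?_
      by_cases j0 : j = i₀
      · simp [j0]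
      by_cases j1 : j = i₁
      · simp [j1]
      simp [j0, j1])
  convert h2 using 1
  have e3 : (v i₀).comp b' * p.comp b' + (v i₁).comp b' * q.comp b' = C c := by
    simpa using congrArg (fun x => x.comp b') h
  have : ∑ i, (Pi.single i₀ (p.comp b') + Pi.single i₁ (q.comp b') : ι → R[X]) i * w i = C c := by
    simp only [Pi.add_apply, add_mul, Finset.sum_add_distrib, Pi.single_apply, ite_mul, zero_mul,
      Finset.sum_ite_eq', Finset.mem_univ, if_true, w0, w1]
    linear_combination e3
  rw [this]
  funext j
  simp only [Pi.add_apply, Pi.smul_apply, smul_eq_mul, hw]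
  split_ifs with j0 j1
  · simp [j0]
  · simp [j1]
  · exact hD j

lemma exists_field {R : Type u} [CommRing R] (m : Ideal R) (hm : m.IsMaximal) :
    ∃ (K : Type u) (_ : Field K) (φ : R →+* K), Function.Surjective φ ∧ ∀ c, c ∈ m → φ c = 0 :=
  ⟨R ⧸ m, Ideal.Quotient.field m, Ideal.Quotient.mk m, Ideal.Quotient.mk_surjective,
    fun _ hc => Ideal.Quotient.eq_zero_iff_mem.2 hc⟩

lemma suslin_local {R K : Type*} [CommRing R] [IsDomain R] [Field K] (v u : ι → R[X])
    (h : ∑ i, u i * v i = 1) (i₀ i₁ : ι) (hi : i₀ ≠ i₁) (hmon : (v i₀).Monic)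
    (φ : R →+* K) (hφ : Function.Surjective φ) :
    ∃ c, φ c ≠ 0 ∧ ∀ b b' : R[X], C c ∣ b' - b →
        VEq (fun i => (v i).comp b) (fun i => (v i).comp b') := by
  obtain ⟨a, ha0, ha1, hcop⟩ := stableVec (fun i => (v i).map φ) (fun i => (u i).map φ)
    (by simpa [Polynomial.map_sum] using congrArg (Polynomial.map φ) h) i₀ i₁ (hmon.map φ).ne_zero
  choose a' ha' using fun i => Polynomial.map_surjective φ hφ (a i)
  let a'' : ι → R[X] := fun j => if j = i₁ then 0 else a' j
  have ha'' : ∀ j, (a'' j).map φ = a j := by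
    intro j; simp only [a'']; split_ifs with hj
    · simp [hj, ha1]
    · exact ha' j
  set w : ι → R[X] := v + (∑ j, a'' j * v j) • (Pi.single i₁ 1 : ι → R[X]) with hw
  have w0 : w i₀ = v i₀ := by simp [hw, hi]
  have w1 : w i₁ = v i₁ + ∑ j, a'' j * v j := by simp [hw]
  obtain ⟨c, hcm, p, q, hpq⟩ := exists_const φ (w i₀) (w i₁) (w0 ▸ hmon) (by
    rw [w0, w1]
    simpa [Polynomial.map_sum, ha''] using hcop)
  have hvw : VEq v w := VEq.trv a'' (Pi.single i₁ 1) v (by simp [Pi.single_apply, a''])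
  have hvw' : ∀ b : R[X], VEq (fun i => (v i).comp b) (fun i => (w i).comp b) := fun b =>
    hvw.map (Polynomial.compRingHom b)
  refine ⟨c, hcm, ?_⟩
  intro b b' hb
  exact ((hvw' b).trans (suslin_step w i₀ i₁ hi c (fun h0 => hcm (by simp [h0])) p q hpq b b'
    hb)).trans (hvw' b').symm

lemma suslin {R : Type*} [CommRing R] [IsDomain R] [Nontrivial ι] (v u : ι → R[X])
    (h : ∑ i, u i * v i = 1) (i₀ : ι) (hmon : (v i₀).Monic) :
    VEq v (fun i => C ((v i).eval 0)) := by
  obtain ⟨i₁, hi'⟩ := exists_ne i₀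
  have hi := hi'.symm
  let I : Ideal R :=
    { carrier := {c | ∀ b b' : R[X], C c ∣ b' - b →
        VEq (fun i => (v i).comp b) (fun i => (v i).comp b')}
      zero_mem' := by
        intro b b' hb
        have : b' = b := by simpa [sub_eq_zero] using hb
        rw [this]; exact VEq.refl _
      add_mem' := by
        intro c d hc hd b b' ⟨x, hx⟩
        refine (hc b (b + C c * x) ⟨x, by ring⟩).trans (hd _ _ ⟨x, ?_⟩)
        rw [map_add] at hx
        linear_combination hx
      smul_mem' := by
        intro a c hc b b' hb
        refine hc b b' (Dvd.dvd.trans ⟨C a, ?_⟩ hb)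
        simp [mul_comm] }
  have hI : I = ⊤ := by
    by_contra hne
    obtain ⟨m, hm, hle⟩ := Ideal.exists_le_maximal I hne
    obtain ⟨K, hK, φ, hφ, hker⟩ := exists_field m hm
    obtain ⟨c, hcm, hc⟩ := suslin_local v u h i₀ i₁ hi hmon φ hφ
    exact hcm (hker c (hle hc))
  have h1 : (1 : R) ∈ I := hI ▸ Submodule.mem_top
  have := h1 X 0 (by simp)
  simpa using this

end

section
open Polynomial

lemma suslin' {ι : Type*} [Fintype ι] [DecidableEq ι] {R : Type*} [CommRing R] [IsDomain R]
    [Nontrivial ι] (v u : ι → R[X])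
    (h : ∑ i, u i * v i = 1) (i₀ : ι) (hmon : IsUnit (v i₀).leadingCoeff) :
    VEq v (fun i => C ((v i).eval 0)) := by
  obtain ⟨a, ha⟩ := hmon.exists_left_inv
  have hm : (C a * v i₀).Monic := by
    rw [Monic, leadingCoeff_mul, leadingCoeff_C, ha]
  have := suslin (fun i => C a * v i) (fun i => C (v i₀).leadingCoeff * u i) (by
    rw [← h]
    refine Finset.sum_congr rfl fun i _ => ?_
    have : (C a * C (v i₀).leadingCoeff : R[X]) = 1 := by rw [← C_mul, ha, C_1]
    linear_combination (u i * v i) * this) i₀ hm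
  obtain ⟨M, hM, hMv⟩ := this
  refine ⟨M, hM, ?_⟩
  have hcan : (C (v i₀).leadingCoeff * C a : R[X]) = 1 := by rw [← C_mul, mul_comm, ha, C_1]
  have e : ∀ x : R[X], x = C (v i₀).leadingCoeff * (C a * x) := fun x => by
    rw [← mul_assoc, hcan, one_mul]
  have h2 : M.mulVec (fun i => C a * v i) = C a • M.mulVec v := by
    rw [← Matrix.mulVec_smul]; rfl
  rw [h2] at hMv
  funext i
  have h3 := congrFun hMv i
  simp only [Pi.smul_apply, smul_eq_mul, eval_mul, eval_C, C_mul] at h3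
  rw [e (M.mulVec v i), h3, ← e]

end
section equivT
open Polynomial MvPolynomial Ideal Nat RingHom List

variable {k : Type*} [Field k] {n : ℕ} (f : MvPolynomial (Fin (n + 1)) k)
variable (v w : Fin (n + 1) →₀ ℕ)

variable {f v} in
lemma lt_up (vlt : ∀ i, v i < (2 + f.totalDegree)) : ∀ l ∈ ofFn v, l < (2 + f.totalDegree) := by
  grind

noncomputable abbrev T1 (c : k) :
    MvPolynomial (Fin (n + 1)) k →ₐ[k] MvPolynomial (Fin (n + 1)) k :=
  aeval fun i ↦ if i = 0 then X 0 else X i + c • X 0 ^ (2 + f.totalDegree) ^ i.1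

lemma t1_comp_t1_neg (c : k) : (T1 f c).comp (T1 f (-c)) = AlgHom.id _ _ := by
  rw [comp_aeval, ← MvPolynomial.aeval_X_left]
  ext i v
  cases i using Fin.cases <;> simp

noncomputable abbrev T := AlgEquiv.ofAlgHom (T1 f 1) (T1 f (-1))
  (t1_comp_t1_neg f 1) (by simpa using t1_comp_t1_neg f (-1))

lemma sum_r_mul_ne (vlt : ∀ i, v i < (2 + f.totalDegree)) (wlt : ∀ i, w i < (2 + f.totalDegree)) (ne : v ≠ w) :
    ∑ x : Fin (n + 1), (2 + f.totalDegree) ^ x.1 * v x ≠ ∑ x : Fin (n + 1), (2 + f.totalDegree) ^ x.1 * w x := by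
  intro h
  refine ne <| Finsupp.ext <| congrFun <| ofFn_inj.mp ?_
  apply ofDigits_inj_of_len_eq (Nat.lt_add_right f.totalDegree one_lt_two)
    (by simp) (lt_up vlt) (lt_up wlt)
  simpa only [ofDigits_eq_sum_mapIdx, mapIdx_eq_ofFn, get_ofFn, length_ofFn,
    Fin.val_cast, mul_comm, sum_ofFn] using! h

lemma degreeOf_zero_t {a : k} (ha : a ≠ 0) : ((T f) (monomial v a)).degreeOf 0 =
    ∑ i : Fin (n + 1), ((2 + f.totalDegree) ^ i.1) * v i := by
  rw [← natDegree_finSuccEquiv, monomial_eq, Finsupp.prod_pow v fun a ↦ X a]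
  simp only [Fin.prod_univ_succ, Fin.sum_univ_succ, map_mul, map_prod, map_pow,
    AlgEquiv.ofAlgHom_apply, MvPolynomial.aeval_C, MvPolynomial.aeval_X, if_pos, Fin.succ_ne_zero,
    ite_false, one_smul, map_add, finSuccEquiv_X_zero, finSuccEquiv_X_succ, algebraMap_eq]
  have h (i : Fin n) :
      (Polynomial.C (X (R := k) i) + Polynomial.X ^ (2 + f.totalDegree) ^ i.succ.1) ^ v i.succ ≠ 0 :=
    pow_ne_zero (v i.succ) (leadingCoeff_ne_zero.mp <| by simp [add_comm, leadingCoeff_X_pow_add_C])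
  rw [natDegree_mul (by simp [ha]) (mul_ne_zero (by simp) (Finset.prod_ne_zero_iff.mpr
    (fun i _ ↦ h i))), natDegree_mul (by simp) (Finset.prod_ne_zero_iff.mpr (fun i _ ↦ h i)),
    natDegree_prod _ _ (fun i _ ↦ h i), natDegree_finSuccEquiv, degreeOf_C]
  simpa only [natDegree_pow, zero_add, natDegree_X, mul_one, Fin.val_zero, pow_zero, one_mul,
    add_right_inj] using Finset.sum_congr rfl (fun i _ ↦ by
    rw [add_comm (Polynomial.C _), natDegree_X_pow_add_C, mul_comm])

lemma degreeOf_t_ne_of_ne (hv : v ∈ f.support) (hw : w ∈ f.support) (ne : v ≠ w) :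
    (T f <| monomial v <| coeff v f).degreeOf 0 ≠
    (T f <| monomial w <| coeff w f).degreeOf 0 := by
  rw [degreeOf_zero_t _ _ <| mem_support_iff.mp hv, degreeOf_zero_t _ _ <| mem_support_iff.mp hw]
  refine sum_r_mul_ne f v w (fun i ↦ ?_) (fun i ↦ ?_) ne <;>
  exact lt_of_le_of_lt ((monomial_le_degreeOf i ‹_›).trans (degreeOf_le_totalDegree f i))
    (by lia)

lemma leadingCoeff_finSuccEquiv_t :
    (finSuccEquiv k n ((T f) ((monomial v) (coeff v f)))).leadingCoeff =
    algebraMap k _ (coeff v f) := by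
  rw [monomial_eq, Finsupp.prod_fintype]
  · simp only [map_mul, map_prod, leadingCoeff_mul, leadingCoeff_prod]
    rw [AlgEquiv.ofAlgHom_apply, algHom_C, algebraMap_eq, finSuccEquiv_apply,
      eval₂Hom_C, coe_comp]
    simp only [AlgEquiv.ofAlgHom_apply, Function.comp_apply, leadingCoeff_C, map_pow,
      leadingCoeff_pow, algebraMap_eq]
    have : ∀ j, ((finSuccEquiv k n) ((T1 f) 1 (X j))).leadingCoeff = 1 := fun j ↦ by
      by_cases h : j = 0
      · simp [h, finSuccEquiv_apply]
      · simp only [aeval_eq_bind₁, bind₁_X_right, if_neg h, one_smul, map_add, map_pow]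
        obtain ⟨i, rfl⟩ := Fin.exists_succ_eq.mpr h
        simp [finSuccEquiv_X_succ, finSuccEquiv_X_zero, add_comm]
    simp only [this, one_pow, Finset.prod_const_one, mul_one]
  exact fun i ↦ pow_zero _

lemma T_leadingcoeff_isUnit (fne : f ≠ 0) :
    IsUnit (finSuccEquiv k n (T f f)).leadingCoeff := by
  obtain ⟨v, vin, vs⟩ := Finset.exists_max_image f.support
    (fun v ↦ (T f ((monomial v) (coeff v f))).degreeOf 0) (support_nonempty.mpr fne)
  set h := fun w ↦ (MvPolynomial.monomial w) (coeff w f)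
  simp only [← natDegree_finSuccEquiv] at vs
  replace vs : ∀ x ∈ f.support \ {v}, (finSuccEquiv k n ((T f) (h x))).degree <
      (finSuccEquiv k n ((T f) (h v))).degree := by
    intro x hx
    obtain ⟨h1, h2⟩ := Finset.mem_sdiff.mp hx
    apply degree_lt_degree <| lt_of_le_of_ne (vs x h1) ?_
    simpa only [natDegree_finSuccEquiv]
      using degreeOf_t_ne_of_ne f _ _ h1 vin <| ne_of_not_mem_cons h2
  have coeff : (finSuccEquiv k n ((T f) (h v + ∑ x ∈ f.support \ {v}, h x))).leadingCoeff =
      (finSuccEquiv k n ((T f) (h v))).leadingCoeff := by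
    simp only [map_add, map_sum]
    rw [add_comm]
    apply leadingCoeff_add_of_degree_lt <| (lt_of_le_of_lt <| degree_sum_le _ _) ?_
    have h2 : h v ≠ 0 := by simpa [h] using mem_support_iff.mp vin
    replace h2 : (finSuccEquiv k n ((T f) (h v))) ≠ 0 := fun eq ↦ h2 <|
      by simpa only [map_eq_zero_iff _ (AlgEquiv.injective _)] using eq
    exact (Finset.sup_lt_iff <| Ne.bot_lt (fun x ↦ h2 <| degree_eq_bot.mp x)).mpr vs
  nth_rw 2 [← f.support_sum_monomial_coeff]
  rw [Finset.sum_eq_add_sum_sdiff_singleton_of_mem vin h]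
  rw [leadingCoeff_finSuccEquiv_t] at coeff
  simpa only [coeff, algebraMap_eq] using (mem_support_iff.mp vin).isUnit.map MvPolynomial.C

end equivT

section
open MvPolynomial
variable {ι : Type*} [Fintype ι] [DecidableEq ι]

lemma VEq.single_of_unit' {A : Type*} [CommRing A] [Nontrivial ι] (i₀ i₁ : ι) (v : ι → A)
    (h : IsUnit (v i₁)) : VEq v (Pi.single i₀ 1) := by
  by_cases hi : i₀ = i₁
  · obtain ⟨i₂, h2⟩ := exists_ne i₁
    refine (VEq.single_of_unit i₂ i₁ h2 v h).trans ?_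
    exact VEq.single_of_unit i₀ i₂ (hi ▸ h2.symm) _ (by simp)
  · exact VEq.single_of_unit i₀ i₁ hi v h

lemma exists_ne_zero {A : Type*} [CommRing A] [Nontrivial A] (v u : ι → A)
    (h : ∑ i, u i * v i = 1) : ∃ i, v i ≠ 0 := by
  by_contra! hn
  simp [hn] at h

lemma column (k : Type*) [Field k] [Nontrivial ι] (i₀ : ι) (N : ℕ) :
    ∀ v u : ι → MvPolynomial (Fin N) k, ∑ i, u i * v i = 1 → VEq v (Pi.single i₀ 1) := by
  induction N with
  | zero =>
    intro v u h
    obtain ⟨i, hi⟩ := exists_ne_zero v u h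
    refine VEq.single_of_unit' i₀ i v ?_
    rw [eq_C_of_isEmpty (v i)] at hi ⊢
    refine IsUnit.map C (isUnit_iff_ne_zero.2 fun h0 => hi ?_)
    rw [h0, map_zero]
  | succ N ih =>
    intro v u h
    obtain ⟨i, hi⟩ := exists_ne_zero v u h
    let ψ := (T (v i)).trans (finSuccEquiv k N)
    have hl : IsUnit (ψ (v i)).leadingCoeff := T_leadingcoeff_isUnit (v i) hi
    have h' : ∑ i, ψ (u i) * ψ (v i) = 1 := by
      simpa using congrArg ψ h
    have h1 := suslin' (fun i => ψ (v i)) (fun i => ψ (u i)) h' i hl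
    have h2 := ih (fun i => (ψ (v i)).eval 0) (fun i => (ψ (u i)).eval 0) (by
      simpa [Polynomial.eval_finsetSum] using congrArg (Polynomial.eval 0) h')
    have h3 := (h1.trans (h2.map Polynomial.C)).map (ψ.symm : _ →+* MvPolynomial (Fin (N+1)) k)
    convert h3 using 1
    · funext j; simp
    · funext j
      by_cases hj : j = i₀
      · subst hj; simp
      · simp [hj]

lemma exists_leftInv {A : Type*} [CommRing A] {m n : ℕ} (F : Matrix (Fin m) (Fin n) A)
    (h : Ideal.span {p : A | ∃ rows : Fin n → Fin m, Function.Injective rows ∧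
            p = (F.submatrix rows id).det} = ⊤) :
    ∃ G : Matrix (Fin n) (Fin m) A, G * F = 1 := by
  let I : Ideal A :=
    { carrier := {p | ∃ G : Matrix (Fin n) (Fin m) A, G * F = p • (1 : Matrix (Fin n) (Fin n) A)}
      zero_mem' := ⟨0, by simp⟩
      add_mem' := by
        rintro p q ⟨G, hG⟩ ⟨H, hH⟩
        exact ⟨G + H, by rw [Matrix.add_mul, hG, hH, add_smul]⟩
      smul_mem' := by
        rintro a p ⟨G, hG⟩
        exact ⟨a • G, by rw [Matrix.smul_mul, hG, smul_assoc]⟩ }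
  have hI : (1 : A) ∈ I := by
    have : (⊤ : Ideal A) ≤ I := by
      rw [← h, Ideal.span_le]
      rintro p ⟨rows, -, rfl⟩
      refine ⟨(F.submatrix rows id).adjugate * (1 : Matrix (Fin m) (Fin m) A).submatrix rows id, ?_⟩
      rw [← Matrix.adjugate_mul, Matrix.mul_assoc]
      congr 1
      ext i j
      simp [Matrix.mul_apply, Matrix.one_apply]
    exact this Submodule.mem_top
  obtain ⟨G, hG⟩ := hI
  exact ⟨G, by simpa using hG⟩

lemma complete {A : Type*} [CommRing A]
    (hcol : ∀ (m : ℕ) (v u : Fin (m + 2) → A), ∑ i, u i * v i = 1 → VEq v (Pi.single 0 1))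
    (n : ℕ) : ∀ (m : ℕ), n < m → ∀ (F : Matrix (Fin m) (Fin n) A) (G : Matrix (Fin n) (Fin m) A),
    G * F = 1 → ∃ M : Matrix (Fin m) (Fin m) A, IsUnit M.det ∧
      M * F = Matrix.of (fun (i : Fin m) (j : Fin n) => if (i : ℕ) = (j : ℕ) then 1 else 0) := by
  induction n with
  | zero =>
    intro m hm F G h
    exact ⟨1, by simp, by ext i j; exact j.elim0⟩
  | succ n ih =>
    intro m hm F G h
    obtain ⟨m, rfl⟩ : ∃ m', m = m' + 2 := ⟨m - 2, by omega⟩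
    obtain ⟨M, hM, hMv⟩ := hcol m (fun i => F i 0) (fun i => G 0 i) (by
      have := congrFun (congrFun h 0) 0
      simpa [Matrix.mul_apply] using this)
    -- F' = M * F
    have hGF : (G * M⁻¹) * (M * F) = 1 := by
      rw [Matrix.mul_assoc, ← Matrix.mul_assoc M⁻¹, Matrix.nonsing_inv_mul _ hM, Matrix.one_mul, h]
    have hc : ∀ i, (M * F) i 0 = (Pi.single 0 1 : Fin (m + 2) → A) i := fun i => by
      rw [← hMv]; rfl
    set F₁ := M * F with hF₁
    set G₁ := G * M⁻¹
    have hG0 : ∀ i, i ≠ 0 → G₁ i 0 = 0 := by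
      intro i hi
      have := congrFun (congrFun hGF i) 0
      simpa [Matrix.mul_apply, hc, Pi.single_apply, hi] using this
    obtain ⟨M₂, hM₂, hMF₂⟩ := ih (m + 1) (by omega) (F₁.submatrix Fin.succ Fin.succ)
      (G₁.submatrix Fin.succ Fin.succ) (by
        ext i j
        have := congrFun (congrFun hGF i.succ) j.succ
        rw [Matrix.mul_apply, Fin.sum_univ_succ, hG0 _ (Fin.succ_ne_zero i), zero_mul, zero_add] at this
        simpa [Matrix.mul_apply, Matrix.one_apply] using this)
    -- block matrix
    let r : Fin (m + 1) → A := fun j => if hj : (j : ℕ) < n then F₁ 0 (Fin.succ ⟨j, hj⟩) else 0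
    let P : Matrix (Fin (m + 2)) (Fin (m + 2)) A := Matrix.of (Fin.cons (Fin.cons 1 (-(Matrix.vecMul r M₂)))
      (fun i => Fin.cons 0 (M₂ i)))
    have hP : P.det = M₂.det := by
      rw [Matrix.det_succ_column_zero, Fin.sum_univ_succ]
      have : P.submatrix Fin.succ Fin.succ = M₂ := by
        ext i j; simp [P]
      simp [P] at this ⊢
      rw [this]
    have hrow : ∀ i, ∀ j : Fin n, ∑ l, M₂ i l * F₁ l.succ j.succ = if (i : ℕ) = (j : ℕ) then 1 else 0 := by
      intro i j
      have := congrFun (congrFun hMF₂ i) j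
      simpa [Matrix.mul_apply] using this
    refine ⟨P * M, ?_, ?_⟩
    · rw [Matrix.det_mul, hP]; exact hM₂.mul hM
    · rw [Matrix.mul_assoc, ← hF₁]
      ext i j
      rw [Matrix.mul_apply, Fin.sum_univ_succ]
      refine Fin.cases ?_ (fun i => ?_) i <;> refine Fin.cases ?_ (fun j => ?_) j
      · simp [P, hc]
      · have e : ∑ x : Fin (m + 1), (Matrix.vecMul r M₂) x * F₁ x.succ j.succ = F₁ 0 j.succ := by
          simp only [Matrix.vecMul, dotProduct, Finset.sum_mul, mul_assoc]
          rw [Finset.sum_comm]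
          simp only [← Finset.mul_sum, hrow]
          rw [Finset.sum_eq_single (⟨j, by omega⟩ : Fin (m + 1))]
          · simp [r]; rfl
          · intro b _ hb
            rw [if_neg (fun h => hb (Fin.ext h)), mul_zero]
          · simp
        simp [P, e]
      · simp [P, hc]
      · simp [P, hrow]

end
end QS


open MvPolynomial

/-- Let `R = k[x₁,…,x_N]` and let `F` be an `m × n` matrix over `R`
with `m > n` which is unimodular, i.e. the ideal generated by its `n × n` minors
is all of `R`.  Then there is an invertible (unimodular) `m × m` matrix `M` over
`R` with `M · F = [Iₙ; 0]`. -/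
theorem unimodular_column_completion
    (k : Type) [Field k] (N m n : ℕ) (hmn : n < m)
    (F : Matrix (Fin m) (Fin n) (MvPolynomial (Fin N) k))
    (hUnimod : Ideal.span
        {p : MvPolynomial (Fin N) k |
          ∃ rows : Fin n → Fin m, Function.Injective rows ∧
            p = (F.submatrix rows id).det} = ⊤) :
    ∃ M : Matrix (Fin m) (Fin m) (MvPolynomial (Fin N) k),
      IsUnit M.det ∧
      M * F = Matrix.of (fun (i : Fin m) (j : Fin n) =>
        if (i : ℕ) = (j : ℕ) then 1 else 0) := by

  obtain ⟨G, hG⟩ := QS.exists_leftInv F hUnimod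
  exact QS.complete (fun m v u h => QS.column k 0 N v u h) n m hmn F G hG
end

section
/- Let k be an infinite field and a_1,a_2,a_3,a_4 ∈ k[s,t] with gcd(a_1,a_2,a_3,a_4) = 1 and d = max deg(a_i). If the homogenized ideal Î = (b_1,b_2,b_3,b_4) ⊂ k[s,t,u] (with b_i the degree-d homogenization of a_i) has projective dimension 1, then Syz(a_1,a_2,a_3,a_4) admits a free basis of three vectors in k[s,t]^4 each of total degree at most d. -/
open MvPolynomial

abbrev R2 (k : Type) [Field k] := MvPolynomial (Fin 2) k
abbrev S3 (k : Type) [Field k] := MvPolynomial (Fin 3) k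

/-- Dehomogenization `k[s,t,u] → k[s,t]`, sending `s ↦ s`, `t ↦ t`, `u ↦ 1`. -/
noncomputable def dehom (k : Type) [Field k] : S3 k →ₐ[k] R2 k :=
  aeval ![X 0, X 1, 1]

section helpers
variable {k : Type} [Field k]

lemma hc_mul_le (c p : S3 k) (μ n : ℕ) (hp : p.IsHomogeneous μ) (h : μ ≤ n) :
    homogeneousComponent n (c * p) = homogeneousComponent (n - μ) c * p := by
  let _ : GradedAlgebra (homogeneousSubmodule (Fin 3) k) := gradedAlgebra
  have := DirectSum.coe_decompose_mul_of_right_mem_of_le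
    (homogeneousSubmodule (Fin 3) k) (a := c) (b := p) (i := μ) (n := n) hp h
  erw [decomposition.decompose'_apply, decomposition.decompose'_apply] at this
  exact this

lemma hc_mul_not_le (c p : S3 k) (μ n : ℕ) (hp : p.IsHomogeneous μ) (h : ¬ μ ≤ n) :
    homogeneousComponent n (c * p) = 0 := by
  let _ : GradedAlgebra (homogeneousSubmodule (Fin 3) k) := gradedAlgebra
  have := DirectSum.coe_decompose_mul_of_right_mem_of_not_le
    (homogeneousSubmodule (Fin 3) k) (a := c) (b := p) (i := μ) (n := n) hp h
  erw [decomposition.decompose'_apply] at this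
  exact this

/-- coefficient of the homogeneous relation -/
noncomputable def sc (n μ : ℕ) (c : S3 k) : S3 k :=
  if μ ≤ n then homogeneousComponent (n - μ) c else 0

lemma hc_mul (c p : S3 k) (μ n : ℕ) (hp : p.IsHomogeneous μ) :
    homogeneousComponent n (c * p) = sc n μ c * p := by
  unfold sc
  split_ifs with h
  · exact hc_mul_le c p μ n hp h
  · rw [hc_mul_not_le c p μ n hp h, zero_mul]

lemma sc_self (n : ℕ) (c : S3 k) : sc n n c = C (coeff 0 c) := by
  simp [sc]

lemma sc_lt (n μ : ℕ) (c : S3 k) (h : n < μ) : sc n μ c = 0 := by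
  simp [sc, not_le.2 h]

lemma exists_hom (p : R2 k) (e : ℕ) (he : p.totalDegree ≤ e) :
    ∃ P : S3 k, P.IsHomogeneous e ∧ dehom k P = p := by
  refine ⟨∑ n ∈ Finset.range (e + 1),
    rename Fin.castSucc (homogeneousComponent n p) * X 2 ^ (e - n), ?_, ?_⟩
  · apply IsHomogeneous.sum
    intro n hn
    have h1 : n ≤ e := by simpa [Nat.lt_succ_iff] using hn
    have := ((homogeneousComponent_isHomogeneous n p).rename_isHomogeneous
      (f := (Fin.castSucc : Fin 2 → Fin 3))).mul (isHomogeneous_X_pow (R := k) (2 : Fin 3) (e - n))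
    rwa [Nat.add_sub_cancel' h1] at this
  · have h2 : ∀ q : R2 k, dehom k (rename Fin.castSucc q) = q := by
      intro q
      unfold dehom
      rw [aeval_rename]
      have : (![X 0, X 1, 1] : Fin 3 → R2 k) ∘ Fin.castSucc = X := by
        ext i : 1; fin_cases i <;> rfl
      rw [this, aeval_X_left_apply]
    have h3 : dehom k (X 2) = 1 := by simp [dehom]
    simp only [map_sum, map_mul, map_pow, h2, h3, one_pow, mul_one]
    conv_rhs => rw [← sum_homogeneousComponent p]
    symm
    apply Finset.sum_subset
    · intro x; simp only [Finset.mem_range]; omega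
    · intro x _ hx
      apply homogeneousComponent_eq_zero
      simp only [Finset.mem_range] at hx; omega

lemma hom_eval_smul (P : S3 k) (e : ℕ) (hP : P.IsHomogeneous e) (z : k) (x : Fin 3 → k) :
    eval (fun i => z * x i) P = z ^ e * eval x P := by
  rw [eval_eq', eval_eq', Finset.mul_sum]
  apply Finset.sum_congr rfl
  intro m hm
  have : m.degree = e := by
    by_contra h
    exact (mem_support_iff.1 hm) (hP.coeff_eq_zero h)
  simp only [mul_pow, Finset.prod_mul_distrib]
  rw [Finset.prod_pow_eq_pow_sum]
  have h2 : ∑ i, m i = e := by rw [← this, Finsupp.degree_eq_sum]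
  rw [h2]; ring

lemma dehom_inj [Infinite k] (P : S3 k) (e : ℕ) (hP : P.IsHomogeneous e) (h : dehom k P = 0) :
    P = 0 := by
  have key : P * X 2 = 0 := by
    apply MvPolynomial.funext
    intro x
    simp only [map_mul, eval_X, map_zero]
    by_cases hz : x 2 = 0
    · simp [hz]
    · have h1 : eval ![x 0 / x 2, x 1 / x 2] (dehom k P) = 0 := by rw [h]; simp
      have h2 : eval ![x 0 / x 2, x 1 / x 2] (dehom k P) = eval ![x 0 / x 2, x 1 / x 2, 1] P := by
        have : (eval ![x 0 / x 2, x 1 / x 2]).comp (dehom k).toRingHom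
            = eval (![x 0 / x 2, x 1 / x 2, 1] : Fin 3 → k) := by
          apply MvPolynomial.ringHom_ext
          · intro r; simp [dehom]
          · intro i; fin_cases i <;> simp [dehom]
        exact RingHom.congr_fun this P
      have h3 := hom_eval_smul P e hP (x 2) ![x 0 / x 2, x 1 / x 2, 1]
      have h4 : (fun i => x 2 * (![x 0 / x 2, x 1 / x 2, 1] : Fin 3 → k) i) = x := by
        ext i; fin_cases i <;> simp <;> field_simp
      rw [h4, ← h2, h1] at h3
      rw [h3]; simp
  exact (mul_eq_zero.1 key).resolve_right (X_ne_zero _)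

lemma dehom_deg (P : S3 k) (e : ℕ) (hP : P.IsHomogeneous e) :
    (dehom k P).totalDegree ≤ e := by
  unfold dehom
  rw [aeval_def, eval₂_eq']
  apply totalDegree_finsetSum_le
  intro m hm
  have : m.degree = e := by
    by_contra h
    exact (mem_support_iff.1 hm) (hP.coeff_eq_zero h)
  rw [Finsupp.degree_eq_sum] at this
  simp only [Fin.sum_univ_three] at this
  simp only [Fin.prod_univ_three]
  refine (totalDegree_mul _ _).trans ?_
  have h0 : (algebraMap k (R2 k) (coeff m P)).totalDegree = 0 := totalDegree_C _
  have h1 : ((X 0 : R2 k) ^ m 0).totalDegree = m 0 := totalDegree_X_pow _ _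
  have h2 : ((X 1 : R2 k) ^ m 1).totalDegree = m 1 := totalDegree_X_pow _ _
  have h3 := totalDegree_mul ((X 0 : R2 k) ^ m 0) ((X 1 : R2 k) ^ m 1)
  simp only [Matrix.cons_val, one_pow, mul_one]
  omega

lemma schanuel {S : Type} [CommRing S] {P Q F : Type} [AddCommGroup P] [AddCommGroup Q]
    [AddCommGroup F] [Module S P] [Module S Q] [Module S F] [Module.Projective S P]
    [Module.Projective S Q] [Module.Projective S F] (ε : P →ₗ[S] S) (ι : Q →ₗ[S] P)
    (φ : F →ₗ[S] S) (h1 : LinearMap.range ε = LinearMap.range φ)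
    (h2 : LinearMap.ker ε = LinearMap.range ι) (h3 : LinearMap.ker ι = ⊥) :
    Module.Projective S (LinearMap.ker φ) := by
  have hα : ∃ α : P →ₗ[S] F, φ ∘ₗ α = ε := by
    obtain ⟨α, hα⟩ := Module.projective_lifting_property φ.rangeRestrict
      (ε.codRestrict (LinearMap.range φ) (fun x => h1 ▸ ⟨x, rfl⟩)) φ.surjective_rangeRestrict
    exact ⟨α, by ext x : 1; exact congrArg Subtype.val (LinearMap.congr_fun hα x)⟩
  have hβ : ∃ β : F →ₗ[S] P, ε ∘ₗ β = φ := by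
    obtain ⟨α, hα⟩ := Module.projective_lifting_property ε.rangeRestrict
      (φ.codRestrict (LinearMap.range ε) (fun x => h1 ▸ ⟨x, rfl⟩)) ε.surjective_rangeRestrict
    exact ⟨α, by ext x : 1; exact congrArg Subtype.val (LinearMap.congr_fun hα x)⟩
  obtain ⟨α, hα⟩ := hα
  obtain ⟨β, hβ⟩ := hβ
  have hα' : ∀ x, φ (α x) = ε x := fun x => LinearMap.congr_fun hα x
  have hβ' : ∀ x, ε (β x) = φ x := fun x => LinearMap.congr_fun hβ x
  have e : Q ≃ₗ[S] LinearMap.ker ε :=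
    (LinearEquiv.ofInjective ι (LinearMap.ker_eq_bot.1 h3)).trans (LinearEquiv.ofEq _ _ h2.symm)
  have : Module.Projective S (LinearMap.ker ε) := Module.Projective.of_equiv e
  let i : LinearMap.ker φ →ₗ[S] (LinearMap.ker ε × F) :=
    LinearMap.prod ((β ∘ₗ (LinearMap.ker φ).subtype).codRestrict (LinearMap.ker ε)
      (fun x => by simp [hβ'])) (LinearMap.ker φ).subtype
  let r : (LinearMap.ker ε × F) →ₗ[S] LinearMap.ker φ :=
    LinearMap.codRestrict (LinearMap.ker φ)
      (LinearMap.coprod (α ∘ₗ (LinearMap.ker ε).subtype) (LinearMap.id - α ∘ₗ β))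
      (fun x => by simp [hα', hβ'])
  apply Module.Projective.of_split i r
  apply LinearMap.ext
  intro x
  apply Subtype.ext
  change α (β x) + (x - α (β x)) = x
  abel

lemma hc_ker (b : Fin 4 → S3 k) (d : ℕ) (hb : ∀ i, (b i).IsHomogeneous d)
    (w : Fin 4 → S3 k) (hw : ∑ i, w i * b i = 0) (n : ℕ) :
    ∑ i, homogeneousComponent n (w i) * b i = 0 := by
  have h := congrArg (homogeneousComponent (n + d)) hw
  rw [map_sum, map_zero] at h
  rw [← h]
  apply Finset.sum_congr rfl
  intro i _
  rw [hc_mul_le _ _ d _ (hb i) (by omega), Nat.add_sub_cancel]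

lemma exists_hom_basis (b : Fin 4 → S3 k) (d : ℕ) (hb : ∀ i, (b i).IsHomogeneous d)
    (hproj : Module.Projective (S3 k) (LinearMap.ker (Fintype.linearCombination (S3 k) b))) :
    ∃ (T : Finset (Fin 4 → S3 k)) (μ : T → ℕ),
      (∀ (j : T) i, (j.1 i).IsHomogeneous (μ j)) ∧
      LinearIndependent (S3 k) (fun j : T => j.1) ∧
      Submodule.span (S3 k) (T : Set (Fin 4 → S3 k)) =
        LinearMap.ker (Fintype.linearCombination (S3 k) b) := by
  classical
  set K := LinearMap.ker (Fintype.linearCombination (S3 k) b) with hK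
  have memK : ∀ w, w ∈ K ↔ ∑ i, w i * b i = 0 := by
    intro w
    simp [hK, Fintype.linearCombination_apply]
  let HS : Set (Fin 4 → S3 k) := {w | w ∈ K ∧ ∃ μ : ℕ, ∀ i, (w i).IsHomogeneous μ}
  have hspan : Submodule.span (S3 k) HS = K := by
    apply le_antisymm
    · rw [Submodule.span_le]; intro w hw; exact hw.1
    · intro w hw
      have : w = ∑ n ∈ Finset.range (Finset.univ.sup (fun i => (w i).totalDegree) + 1),
          (fun i => homogeneousComponent n (w i)) := by
        ext1 i
        rw [Finset.sum_apply]
        conv_lhs => rw [← sum_homogeneousComponent (w i)]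
        apply Finset.sum_subset
        · intro x
          have := Finset.le_sup (f := fun i => (w i).totalDegree) (Finset.mem_univ i)
          simp only [Finset.mem_range] at *; omega
        · intro x _ hx
          apply homogeneousComponent_eq_zero
          simp only [Finset.mem_range] at hx; omega
      rw [this]
      apply Submodule.sum_mem
      intro n _
      apply Submodule.subset_span
      refine ⟨?_, n, fun i => homogeneousComponent_isHomogeneous _ _⟩
      rw [memK]
      exact hc_ker b d hb w ((memK w).1 hw) n
  have hex : ∃ n : ℕ, ∃ T : Finset (Fin 4 → S3 k), T.card = n ∧ (T : Set (Fin 4 → S3 k)) ⊆ HS ∧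
      Submodule.span (S3 k) (T : Set (Fin 4 → S3 k)) = K := by
    have hfg : (Submodule.span (S3 k) HS).FG := IsNoetherian.noetherian _
    obtain ⟨T, hT, hT2⟩ := (Submodule.fg_span_iff_fg_span_finset_subset _).1 hfg
    exact ⟨_, T, rfl, hT, by rw [← hT2, hspan]⟩
  obtain ⟨T, hTc, hTH, hTK⟩ := Nat.find_spec hex
  have hmin : ∀ T' : Finset (Fin 4 → S3 k), (T' : Set (Fin 4 → S3 k)) ⊆ HS →
      Submodule.span (S3 k) (T' : Set (Fin 4 → S3 k)) = K → T.card ≤ T'.card := by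
    intro T' h1 h2
    rw [hTc]
    exact Nat.find_min' hex ⟨T', rfl, h1, h2⟩
  choose μ hμ using fun j : T => (hTH j.2).2
  refine ⟨T, μ, hμ, ?_, hTK⟩
  -- the relations have no constant terms
  have hrel : ∀ c : T → S3 k, ∑ j, c j • j.1 = 0 → ∀ j, constantCoeff (c j) = 0 := by
    intro c hc j
    by_contra hne
    rw [constantCoeff_eq] at hne
    have hh : ∑ i, sc (μ j) (μ i) (c i) • i.1 = 0 := by
      ext1 l
      have h1 := congrArg (homogeneousComponent (μ j)) (congrFun hc l)
      simp only [Finset.sum_apply, Pi.smul_apply, smul_eq_mul, map_sum, Pi.zero_apply,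
        map_zero] at h1 ⊢
      rw [← h1]
      exact Finset.sum_congr rfl fun i _ => (hc_mul _ _ _ _ (hμ i l)).symm
    have hmem : j.1 ∈ Submodule.span (S3 k) ((T.erase j.1 : Finset _) : Set (Fin 4 → S3 k)) := by
      rw [← Finset.add_sum_erase _ _ (Finset.mem_univ j), sc_self] at hh
      have h2 : j.1 = (C (-(coeff 0 (c j))⁻¹) : S3 k) •
          ∑ i ∈ Finset.univ.erase j, sc (μ j) (μ i) (c i) • i.1 := by
        rw [← eq_neg_iff_add_eq_zero] at hh
        rw [← neg_eq_iff_eq_neg.2 hh, smul_neg, smul_smul, ← C_mul]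
        have : -(coeff 0 (c j))⁻¹ * coeff 0 (c j) = -1 := by
          rw [neg_mul, inv_mul_cancel₀ hne]
        rw [this]; simp
      rw [h2]
      apply Submodule.smul_mem
      apply Submodule.sum_mem
      intro i hi
      apply Submodule.smul_mem
      apply Submodule.subset_span
      have : i ≠ j := (Finset.mem_erase.1 hi).1
      simp only [Finset.coe_erase, Set.mem_sdiff, Set.mem_singleton_iff]
      exact ⟨i.2, fun h => this (Subtype.ext (h.trans h2.symm))⟩
    have := hmin (T.erase j.1) (fun x hx => hTH (Finset.mem_of_mem_erase hx)) (by
      apply le_antisymm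
      · rw [← hTK]; exact Submodule.span_mono (fun x hx => Finset.mem_of_mem_erase hx)
      · rw [← hTK, Submodule.span_le]
        intro x hx
        by_cases hxj : x = j.1
        · rw [hxj]; exact hmem
        · exact Submodule.subset_span (by simpa using ⟨hx, hxj⟩))
    have h5 := Finset.card_erase_lt_of_mem j.2
    omega
  let f0 : (T → S3 k) →ₗ[S3 k] (Fin 4 → S3 k) := Fintype.linearCombination (S3 k) (fun j : T => j.1)
  have hf0 : ∀ c, f0 c = ∑ j, c j • j.1 := fun c => Fintype.linearCombination_apply _ _ _
  have hrange : LinearMap.range f0 = K := by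
    rw [← hTK]
    have := Fintype.range_linearCombination (S3 k) (fun j : T => j.1)
    rw [Subtype.range_coe_subtype] at this
    exact this
  let f : (T → S3 k) →ₗ[S3 k] K := f0.codRestrict K (fun c => hrange ▸ ⟨c, rfl⟩)
  have hfs : Function.Surjective f := by
    intro y
    have hy : y.1 ∈ LinearMap.range f0 := hrange.symm ▸ y.2
    obtain ⟨c, hc⟩ := hy
    exact ⟨c, Subtype.ext hc⟩
  obtain ⟨g, hg⟩ := Module.projective_lifting_property f LinearMap.id hfs
  have hg' : ∀ y, f (g y) = y := fun y => LinearMap.congr_fun hg y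
  let N := LinearMap.ker f
  let I : Ideal (S3 k) := RingHom.ker (constantCoeff (R := k) (σ := Fin 3))
  let π : (T → S3 k) →ₗ[S3 k] (T → S3 k) := LinearMap.id - g ∘ₗ f
  have hπ : ∀ c, π c ∈ N := by
    intro c
    simp [N, π, hg']
  have hN : N ≤ I • N := by
    intro c hc
    have h1 : π c = c := by
      have : f c = 0 := hc
      simp [π, this]
    have h2 : c = ∑ j, c j • π (Pi.single j 1) := by
      conv_lhs => rw [← h1, pi_eq_sum_univ' c]
      rw [map_sum]
      simp only [map_smul]
    rw [h2]
    apply Submodule.sum_mem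
    intro j _
    apply Submodule.smul_mem_smul _ (hπ _)
    apply hrel
    rw [← hf0]
    exact congrArg Subtype.val (show f c = 0 from hc)
  obtain ⟨r, hr1, hr2⟩ := Submodule.exists_sub_one_mem_and_smul_eq_zero_of_fg_of_le_smul I N
    (IsNoetherian.noetherian _) hN
  have hr0 : r ≠ 0 := by
    rintro rfl
    have : constantCoeff (0 - 1 : S3 k) = 0 := hr1
    simp at this
  rw [Fintype.linearIndependent_iff]
  intro c hc j
  have h3 : r • c = 0 := hr2 c (by
    change f c = 0
    apply Subtype.ext
    change f0 c = 0
    rw [hf0, hc])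
  have := (smul_eq_zero.1 h3).resolve_left hr0
  rw [this]; rfl

lemma deg_le (b : Fin 4 → S3 k) (d : ℕ) (hb : ∀ i, (b i).IsHomogeneous d)
    (i0 : Fin 4) (hb0 : b i0 ≠ 0)
    (T : Finset (Fin 4 → S3 k)) (μ : T → ℕ) (hμ : ∀ (j : T) i, (j.1 i).IsHomogeneous (μ j))
    (hli : LinearIndependent (S3 k) (fun j : T => j.1))
    (hspan : Submodule.span (S3 k) (T : Set (Fin 4 → S3 k)) =
        LinearMap.ker (Fintype.linearCombination (S3 k) b)) (j : T) : μ j ≤ d := by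
  classical
  by_contra hlt
  push Not at hlt
  have memK : ∀ w, w ∈ Submodule.span (S3 k) (T : Set (Fin 4 → S3 k)) ↔ ∑ i, w i * b i = 0 := by
    intro w
    rw [hspan]
    simp [Fintype.linearCombination_apply]
  have hrange := Fintype.range_linearCombination (S3 k) (fun j : T => j.1)
  rw [Subtype.range_coe_subtype] at hrange
  change _ = Submodule.span (S3 k) (T : Set (Fin 4 → S3 k)) at hrange
  rw [Fintype.linearIndependent_iff] at hli
  have kos : ∀ l, ∃ c : T → S3 k, c j = 0 ∧
      ∑ i, c i • i.1 = (Pi.single l (b i0) - Pi.single i0 (b l) : Fin 4 → S3 k) := by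
    intro l
    have hm : (Pi.single l (b i0) - Pi.single i0 (b l) : Fin 4 → S3 k) ∈
        Submodule.span (S3 k) (T : Set (Fin 4 → S3 k)) := by
      rw [memK]
      simp only [Pi.sub_apply, sub_mul, Finset.sum_sub_distrib]
      simp [Pi.single_apply, mul_comm]
    rw [← hrange] at hm
    obtain ⟨c, hc⟩ := hm
    rw [Fintype.linearCombination_apply] at hc
    refine ⟨fun i => sc d (μ i) (c i), sc_lt _ _ _ hlt, ?_⟩
    rw [← hc]
    ext1 m
    have h1 := congrArg (homogeneousComponent d) (congrFun hc m)
    have hs : ∀ (x y : Fin 4) , ((Pi.single x (b y) : Fin 4 → S3 k) m).IsHomogeneous d := by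
      intro x y
      rw [Pi.single_apply]
      split_ifs
      · exact hb y
      · exact isHomogeneous_zero _ _ _
    have h2 : homogeneousComponent d ((Pi.single l (b i0) - Pi.single i0 (b l) : Fin 4 → S3 k) m)
        = (Pi.single l (b i0) - Pi.single i0 (b l) : Fin 4 → S3 k) m :=
      homogeneousComponent_eq_self ((hs l i0).sub (hs i0 l))
    rw [h2, ← congrFun hc m] at h1
    rw [← h1]
    simp only [Finset.sum_apply, Pi.smul_apply, smul_eq_mul, map_sum]
    exact Finset.sum_congr rfl fun i _ => (hc_mul _ _ _ _ (hμ i m)).symm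
  choose c hc0 hc using kos
  have hj : ∑ i, j.1 i * b i = 0 := (memK j.1).1 (Submodule.subset_span j.2)
  have key : b i0 • j.1 = ∑ l, j.1 l • (Pi.single l (b i0) - Pi.single i0 (b l) : Fin 4 → S3 k) := by
    ext1 m
    simp only [Pi.smul_apply, smul_eq_mul, Finset.sum_apply, Pi.sub_apply, mul_sub,
      Finset.sum_sub_distrib]
    have e1 : ∑ x, j.1 x * (Pi.single i0 (b x) : Fin 4 → S3 k) m = 0 := by
      by_cases hm : m = i0
      · subst hm; simpa using hj
      · simp [hm]
    rw [e1]
    simp [Pi.single_apply, mul_comm]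
  have h0 := hli (fun i => (if i = j then b i0 else 0) - ∑ l, j.1 l * c l i) (by
    simp only [sub_smul, Finset.sum_sub_distrib, ite_smul, zero_smul, Finset.sum_ite_eq',
      Finset.mem_univ, if_true]
    rw [key, sub_eq_zero]
    simp only [← hc, Finset.smul_sum, Finset.sum_smul, smul_smul]
    rw [Finset.sum_comm]) j
  simp [hc0] at h0
  exact hb0 h0

end helpers

theorem mu_basis_of_pd_one
    (k : Type) [Field k] [Infinite k]
    (a : Fin 4 → R2 k) (d : ℕ)
    (hd : d = Finset.univ.sup fun i => (a i).totalDegree)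
    (hgcd : ∀ p : R2 k, (∀ i, p ∣ a i) → IsUnit p)
    (b : Fin 4 → S3 k)
    (hbhom : ∀ i, (b i).IsHomogeneous d)
    (hbdehom : ∀ i, dehom k (b i) = a i)
    (hpd1 : ∃ (r0 r1 : ℕ) (ε : (Fin r0 → S3 k) →ₗ[S3 k] S3 k)
        (ι : (Fin r1 → S3 k) →ₗ[S3 k] (Fin r0 → S3 k)),
        LinearMap.range ε = Ideal.span (Set.range b) ∧
        LinearMap.ker ε = LinearMap.range ι ∧ LinearMap.ker ι = ⊥)
    (hpd0 : ¬ Module.Projective (S3 k) (Ideal.span (Set.range b)))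
    (σ : (Fin 4 → R2 k) →ₗ[R2 k] R2 k)
    (hσ : ∀ h, σ h = ∑ i, h i * a i) :
    ∃ v : Fin 3 → (Fin 4 → R2 k),
      LinearIndependent (R2 k) v ∧
      Submodule.span (R2 k) (Set.range v) = LinearMap.ker σ ∧
      (∀ j i, (v j i).totalDegree ≤ d) := by
  classical
  obtain ⟨r0, r1, ε, ι, hε, hει, hι⟩ := hpd1
  have hproj := schanuel ε ι (Fintype.linearCombination (S3 k) b)
    (by rw [hε, Fintype.range_linearCombination]) hει hι
  obtain ⟨T, μ, hμ, hli, hspan⟩ := exists_hom_basis b d hbhom hproj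
  obtain ⟨i0, ha0⟩ : ∃ i, a i ≠ 0 := by
    by_contra h
    push Not at h
    have := hgcd 0 (fun i => by rw [h i])
    exact not_isUnit_zero this
  have hb0 : b i0 ≠ 0 := by
    intro h
    apply ha0
    rw [← hbdehom, h, map_zero]
  have hdeg := deg_le b d hbhom i0 hb0 T μ hμ hli hspan
  have memK : ∀ w, w ∈ Submodule.span (S3 k) (T : Set (Fin 4 → S3 k)) ↔ ∑ i, w i * b i = 0 := by
    intro w
    rw [hspan]
    simp [Fintype.linearCombination_apply]
  have hrange := Fintype.range_linearCombination (S3 k) (fun j : T => j.1)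
  rw [Subtype.range_coe_subtype] at hrange
  change _ = Submodule.span (S3 k) (T : Set (Fin 4 → S3 k)) at hrange
  let v : T → (Fin 4 → R2 k) := fun j i => dehom k (j.1 i)
  have hvli : LinearIndependent (R2 k) v := by
    rw [Fintype.linearIndependent_iff] at hli ⊢
    intro c hc
    let e := Finset.univ.sup (fun j => (c j).totalDegree) + d
    have hC : ∀ j, ∃ P : S3 k, P.IsHomogeneous (e - μ j) ∧ dehom k P = c j := by
      intro j
      apply exists_hom
      have h1 := Finset.le_sup (f := fun j => (c j).totalDegree) (Finset.mem_univ j)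
      have h2 := hdeg j
      simp only [e] at *
      omega
    choose P hP hPc using hC
    have hz := hli P (by
      ext1 i
      apply dehom_inj _ e
      · rw [Finset.sum_apply]
        apply IsHomogeneous.sum
        intro j _
        have := (hP j).mul (hμ j i)
        rwa [Nat.sub_add_cancel (by have := hdeg j; simp only [e]; omega)] at this
      · have := congrFun hc i
        simpa [hPc, v] using this)
    intro j
    rw [← hPc, hz, map_zero]
  have hvspan : Submodule.span (R2 k) (Set.range v) = LinearMap.ker σ := by
    apply le_antisymm
    · rw [Submodule.span_le]
      rintro _ ⟨j, rfl⟩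
      have hj : ∑ i, j.1 i * b i = 0 := (memK j.1).1 (Submodule.subset_span j.2)
      have := congrArg (dehom k) hj
      simp only [map_sum, map_mul, hbdehom, map_zero] at this
      change σ (v j) = 0
      rw [hσ]
      exact this
    · intro h hh
      have hh' : ∑ i, h i * a i = 0 := by rw [← hσ]; exact hh
      let e := Finset.univ.sup (fun j => (h j).totalDegree)
      have hC : ∀ j, ∃ P : S3 k, P.IsHomogeneous e ∧ dehom k P = h j := fun j =>
        exists_hom _ _ (Finset.le_sup (f := fun j => (h j).totalDegree) (Finset.mem_univ j))
      choose H hH hHh using hC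
      have hHK : ∑ i, H i * b i = 0 := by
        apply dehom_inj _ (e + d)
        · exact IsHomogeneous.sum _ _ _ (fun i _ => (hH i).mul (hbhom i))
        · simpa [hHh, hbdehom] using hh'
      rw [← memK, ← hrange] at hHK
      obtain ⟨c, hc⟩ := hHK
      rw [Fintype.linearCombination_apply] at hc
      have : h = ∑ j, dehom k (c j) • v j := by
        ext1 i
        rw [← hHh, ← hc]
        simp [v]
      rw [this]
      exact Submodule.sum_mem _ fun j _ => Submodule.smul_mem _ _ (Submodule.subset_span ⟨j, rfl⟩)
  have hcard : Fintype.card T = 3 := by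
    have h1 : Module.finrank (R2 k) (LinearMap.ker σ) = Fintype.card T := by
      rw [← hvspan]
      exact finrank_span_eq_card hvli
    have h2 := Submodule.finrank_quotient_add_finrank (LinearMap.ker σ)
    rw [σ.quotKerEquivRange.finrank_eq] at h2
    have h3 : Module.finrank (R2 k) (LinearMap.range σ) = 1 := by
      apply le_antisymm
      · have := Submodule.finrank_le (LinearMap.range σ)
        simpa using this
      · have : Nontrivial (LinearMap.range σ) := by
          refine ⟨⟨⟨a i0, Pi.single i0 1, ?_⟩, 0, ?_⟩⟩
          · rw [hσ]; simp [Pi.single_apply]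
          · intro h; exact ha0 (congrArg Subtype.val h)
        exact Module.finrank_pos
    rw [h1, h3] at h2
    simp at h2
    simp
    omega
  let eq : Fin 3 ≃ T := (Fintype.equivFinOfCardEq hcard).symm
  refine ⟨v ∘ eq, hvli.comp _ eq.injective, ?_, ?_⟩
  · rw [eq.surjective.range_comp, hvspan]
  · intro j i
    exact (dehom_deg _ _ (hμ (eq j) i)).trans (hdeg _)
end
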